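/- Let D_1,…,D_q be hypersurfaces in ℂP^M in N-subgeneral position in a smooth projective variety V ⊂ ℂP^M of dimension n (N ≥ n, q ≥ N+1), with codimension function c on subsets of Q = {1,…,q}. Then for any subsets R_1, R_2 ⊆ Q, one has c(R_1 ∪ R_2) + c(R_1 ∩ R_2) ≤ c(R_1) + c(R_2). -/

import Mathlib

open MvPolynomial Filter

noncomputable section

namespace SMT

/-- The affine cone in `ℂ^K` cut out by an ideal of polynomials
(the common zero set of all its members). -/
def coneOf {K : ℕ} (I : Ideal (MvPolynomial (Fin K) ℂ)) : Set (Fin K → ℂ) :=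
  {x | ∀ Q ∈ I, MvPolynomial.eval x Q = 0}

/-- The vanishing ideal of a subset of `ℂ^K`. -/
def vIdeal {K : ℕ} (A : Set (Fin K → ℂ)) : Ideal (MvPolynomial (Fin K) ℂ) where
  carrier := {Q | ∀ x ∈ A, MvPolynomial.eval x Q = 0}
  add_mem' := by
    intro a b ha hb x hx
    simp [ha x hx, hb x hx]
  zero_mem' := by
    intro x hx
    simp
  smul_mem' := by
    intro c p hp x hx
    simp [smul_eq_mul, hp x hx]

/-- The dimension of (the affine cone over) a subset of `ℂ^K`:
the Krull dimension of its coordinate ring, read off as a natural number. -/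
def coneDim {K : ℕ} (A : Set (Fin K → ℂ)) : ℕ :=
  ENat.toNat ((ringKrullDim (MvPolynomial (Fin K) ℂ ⧸ vIdeal A)).unbotD 0)

/-- `I` is the homogeneous (prime) ideal of a complex projective variety of dimension `n`
in `ℂP^{K-1}`: it is prime, generated by homogeneous polynomials, and the affine cone
has Krull dimension `n + 1`. -/
def IsVariety {K : ℕ} (n : ℕ) (I : Ideal (MvPolynomial (Fin K) ℂ)) : Prop :=
  I.IsPrime ∧
  (∃ S : Set (MvPolynomial (Fin K) ℂ), (∀ Q ∈ S, ∃ e, Q.IsHomogeneous e) ∧ I = Ideal.span S) ∧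
  ringKrullDim (MvPolynomial (Fin K) ℂ ⧸ I) = (((n + 1 : ℕ) : ℕ∞) : WithBot ℕ∞)

/-- A smooth complex projective variety of dimension `n` in `ℂP^{K-1}`, presented by its
homogeneous prime ideal: smoothness via the Jacobian criterion at every nonzero point of
the affine cone. -/
def IsSmoothVariety {K : ℕ} (n : ℕ) (I : Ideal (MvPolynomial (Fin K) ℂ)) : Prop :=
  IsVariety n I ∧
  ∀ x ∈ coneOf I, x ≠ 0 →
    Module.finrank ℂ (Submodule.span ℂ
      {v : Fin K → ℂ | ∃ Q ∈ I, v = fun i => MvPolynomial.eval x (MvPolynomial.pderiv i Q)})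
      = K - 1 - n

/-- The affine cone over the hypersurface defined by a homogeneous polynomial. -/
def hypCone {K : ℕ} (Q : MvPolynomial (Fin K) ℂ) : Set (Fin K → ℂ) :=
  {x | MvPolynomial.eval x Q = 0}

/-- The affine cone over `V ∩ (∩_{j ∈ R} D_j)`. -/
def interCone {K q : ℕ} (I : Ideal (MvPolynomial (Fin K) ℂ))
    (Q : Fin q → MvPolynomial (Fin K) ℂ) (R : Finset (Fin q)) : Set (Fin K → ℂ) :=
  coneOf I ∩ ⋂ j ∈ R, hypCone (Q j)

/-- The codimension function `c(R) = codim_V (V ∩ ∩_{j∈R} D_j)`, with `c(∅) = 0` and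
the convention `codim ∅ = n+1` (the cone over the empty projective set is `{0}`,
of cone dimension `0`). -/
def cdim {K q : ℕ} (n : ℕ) (I : Ideal (MvPolynomial (Fin K) ℂ))
    (Q : Fin q → MvPolynomial (Fin K) ℂ) (R : Finset (Fin q)) : ℕ :=
  n + 1 - coneDim (interCone I Q R)

/-- `ρ(R₁,R₂) = (c(R₂) - c(R₁)) / (#R₂ - #R₁)`. -/
def rho {K q : ℕ} (n : ℕ) (I : Ideal (MvPolynomial (Fin K) ℂ))
    (Q : Fin q → MvPolynomial (Fin K) ℂ) (R₁ R₂ : Finset (Fin q)) : ℝ :=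
  ((cdim n I Q R₂ : ℝ) - (cdim n I Q R₁ : ℝ)) / ((R₂.card : ℝ) - (R₁.card : ℝ))

/-- The hypersurfaces `D_j = {Q j = 0}`, `j ∈ S`, are in general position in the
projective variety `V` (of dimension `n`) defined by `I`: any `s` of them (`1 ≤ s ≤ n+1`)
can be complemented by `n+1-s` further hypersurfaces so that the total intersection with
`V` is empty (in projective space, i.e. the cones meet only in `0`). -/
def GenPos {K q : ℕ} (n : ℕ) (I : Ideal (MvPolynomial (Fin K) ℂ))
    (Q : Fin q → MvPolynomial (Fin K) ℂ) (S : Finset (Fin q)) : Prop :=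
  ∀ J : Finset (Fin q), J ⊆ S → 1 ≤ J.card → J.card ≤ n + 1 →
    ∃ Q' : Fin (n + 1 - J.card) → MvPolynomial (Fin K) ℂ,
      (∀ k, ∃ e, 1 ≤ e ∧ (Q' k).IsHomogeneous e) ∧
      ∀ x ∈ interCone I Q J, (∀ k, MvPolynomial.eval x (Q' k) = 0) → x = 0

/-- A set is algebraic if it is the zero set of its vanishing ideal. -/
def IsAlgSet {K : ℕ} (A : Set (Fin K → ℂ)) : Prop := A = coneOf (vIdeal A)

/-- `σ` is an irreducible component of `S`: an algebraic irreducible subset of `S`,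
maximal among such. -/
def IsIrredComponent {K : ℕ} (σ S : Set (Fin K → ℂ)) : Prop :=
  σ ⊆ S ∧ IsAlgSet σ ∧ (vIdeal σ).IsPrime ∧
  ∀ τ : Set (Fin K → ℂ), τ ⊆ S → IsAlgSet τ → (vIdeal τ).IsPrime → σ ⊆ τ → σ = τ

/-- Condition (i) of Definition 1.1: any `N+1` of the hypersurfaces meet `V` in the
empty (projective) set. -/
def SubgenI {K q : ℕ} (N : ℕ) (I : Ideal (MvPolynomial (Fin K) ℂ))
    (Q : Fin q → MvPolynomial (Fin K) ℂ) : Prop :=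
  ∀ J : Finset (Fin q), J.card = N + 1 → ∀ x ∈ interCone I Q J, x = 0

/-- Condition (ii) of Definition 1.1. -/
def SubgenII {K q : ℕ} (n : ℕ) (I : Ideal (MvPolynomial (Fin K) ℂ))
    (Q : Fin q → MvPolynomial (Fin K) ℂ) : Prop :=
  ∀ J : Finset (Fin q), 0 < J.card → J.card ≤ n + 1 → GenPos n I Q J →
    (∃ x ∈ interCone I Q J, x ≠ 0) →
    ∃ σ : Set (Fin K → ℂ), IsIrredComponent σ (interCone I Q J) ∧
      coneDim σ = coneDim (interCone I Q J) ∧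
      ∀ i ∉ J, coneDim (interCone I Q (insert i J)) = coneDim (interCone I Q J) →
        σ ⊆ hypCone (Q i)

/-- The hypersurfaces `D_j = {Q j = 0}` are in `N`-subgeneral position in the projective
variety `V` defined by `I` (Definition 1.1), including the requirement `V ⊄ D_j`. -/
def InSubgenPos {K q : ℕ} (n N : ℕ) (I : Ideal (MvPolynomial (Fin K) ℂ))
    (Q : Fin q → MvPolynomial (Fin K) ℂ) : Prop :=
  (∀ j, ¬ (coneOf I ⊆ hypCone (Q j))) ∧ SubgenI N I Q ∧ SubgenII n I Q

/-- The Hilbert function `H_X(m) = dim_ℂ ℂ[x]_m / I(m)` of (the variety with homogeneous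
ideal) `I`. -/
def hilbert {K : ℕ} (I : Ideal (MvPolynomial (Fin K) ℂ)) (m : ℕ) : ℕ :=
  Module.finrank ℂ
    ((MvPolynomial.homogeneousSubmodule (Fin K) ℂ m) ⧸
      (Submodule.comap (MvPolynomial.homogeneousSubmodule (Fin K) ℂ m).subtype
        (Submodule.restrictScalars ℂ I)))

/-- The degree of an `n`-dimensional projective variety with homogeneous ideal `I`:
the (unique) natural number `Δ` with `H(m) = Δ·mⁿ/n! + O(m^{n-1})`. -/
def pdeg {K : ℕ} (n : ℕ) (I : Ideal (MvPolynomial (Fin K) ℂ)) : ℕ :=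
  sInf {Δ : ℕ | Filter.Tendsto
    (fun m : ℕ => (hilbert I m : ℝ) * (n.factorial : ℝ) / (m : ℝ) ^ n)
    Filter.atTop (nhds (Δ : ℝ))}

/-- The image cone of the cone of `I` under `x ↦ (Q_1(x), …, Q_q(x))`. -/
def imgCone {K q : ℕ} (I : Ideal (MvPolynomial (Fin K) ℂ))
    (Q : Fin q → MvPolynomial (Fin K) ℂ) : Set (Fin q → ℂ) :=
  (fun x j => MvPolynomial.eval x (Q j)) '' coneOf I

/-! Nevanlinna-theoretic notions. -/

/-- `‖f(z)‖ = max_i |f_i(z)|` for a tuple of functions. -/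
def projNorm {ι : Type*} [Fintype ι] (f : ι → ℂ → ℂ) (z : ℂ) : ℝ :=
  ⨆ i, ‖f i z‖

/-- The Nevanlinna characteristic function
`T_f(r) = (2π)⁻¹ ∫_0^{2π} log ‖f(re^{iθ})‖ dθ`. -/
def charFn {ι : Type*} [Fintype ι] (f : ι → ℂ → ℂ) (r : ℝ) : ℝ :=
  (2 * Real.pi)⁻¹ *
    ∫ θ in (0:ℝ)..(2 * Real.pi),
      Real.log (projNorm f ((r : ℂ) * Complex.exp ((θ : ℂ) * Complex.I)))

/-- The vanishing order of an entire function at a point (the zero divisor). -/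
def zeroOrder (φ : ℂ → ℂ) (z : ℂ) : ℕ :=
  sInf {k : ℕ | iteratedDeriv k φ z ≠ 0}

/-- The (unintegrated) counting function `N_φ(r)` of the zero divisor of `φ`. -/
def count (φ : ℂ → ℂ) (r : ℝ) : ℝ :=
  ∫ t in (1:ℝ)..r, (∑ᶠ z ∈ {z : ℂ | ‖z‖ < t}, ((zeroOrder φ z : ℕ) : ℝ)) / t

/-- The counting function truncated at level `L`. -/
def countTrunc (L : ℕ) (φ : ℂ → ℂ) (r : ℝ) : ℝ :=
  ∫ t in (1:ℝ)..r,
    (∑ᶠ z ∈ {z : ℂ | ‖z‖ < t}, ((min (zeroOrder φ z) L : ℕ) : ℝ)) / t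

/-- A tuple of entire functions without common zeros (a reduced representation of a
holomorphic curve in projective space). -/
def ReducedRepr {ι : Type*} [Fintype ι] (f : ι → ℂ → ℂ) : Prop :=
  (∀ i, Differentiable ℂ (f i)) ∧ ∀ z, ∃ i, f i z ≠ 0

/-- The entire function `Q(f_0, …, f_{K-1})`. -/
def polyComp {K : ℕ} (Q : MvPolynomial (Fin K) ℂ) (f : Fin K → ℂ → ℂ) : ℂ → ℂ :=
  fun z => MvPolynomial.eval (fun i => f i z) Q

/-- The curve with reduced representation `f` has image inside the variety of `I`. -/
def MapsIntoCone {K : ℕ} (f : Fin K → ℂ → ℂ) (I : Ideal (MvPolynomial (Fin K) ℂ)) : Prop :=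
  ∀ z, (fun i => f i z) ∈ coneOf I

/-- `f` is an algebraically nondegenerate holomorphic map into the variety of `I`:
its image is contained in `V` but in no proper algebraic subvariety of `V`. -/
def AlgNondeg {K : ℕ} (f : Fin K → ℂ → ℂ) (I : Ideal (MvPolynomial (Fin K) ℂ)) : Prop :=
  MapsIntoCone f I ∧
  ∀ P : MvPolynomial (Fin K) ℂ, (∃ e, P.IsHomogeneous e) → P ∉ I →
    ∃ z, polyComp P f z ≠ 0

/-- `P r` holds for all `r ∈ [1,∞)` outside a Borel subset `E` of `(1,∞)` of finite
Lebesgue measure. -/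
def ExcSMT (P : ℝ → Prop) : Prop :=
  ∃ E : Set ℝ, MeasurableSet E ∧ E ⊆ Set.Ioi 1 ∧ MeasureTheory.volume E < ⊤ ∧
    ∀ r : ℝ, 1 ≤ r → r ∉ E → P r

theorem eval_smul_hom {K e : ℕ} {p : MvPolynomial (Fin K) ℂ} (hp : p.IsHomogeneous e)
    (t : ℂ) (x : Fin K → ℂ) : eval (t • x) p = t ^ e * eval x p := by
  rw [eval_eq, eval_eq, Finset.mul_sum]
  refine Finset.sum_congr rfl fun s hs => ?_
  have h1 : s.degree = e := by
    have := hp (mem_support_iff.mp hs)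
    rw [Finsupp.degree_eq_weight_one]; exact this
  have : ∏ i ∈ s.support, (t • x) i ^ s i = t ^ e * ∏ i ∈ s.support, x i ^ s i := by
    simp only [Pi.smul_apply, smul_eq_mul, mul_pow, Finset.prod_mul_distrib]
    rw [Finset.prod_pow_eq_pow_sum, ← h1, Finsupp.degree_apply]
  rw [this]; ring

/-- Closed cones. -/
structure Good {K : ℕ} (X : Set (Fin K → ℂ)) : Prop where
  zero : 0 ∈ X
  smul : ∀ x ∈ X, ∀ t : ℂ, t • x ∈ X
  alg : ∀ x, (∀ p ∈ vIdeal X, eval x p = 0) → x ∈ X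

theorem mem_vIdeal {K : ℕ} {X : Set (Fin K → ℂ)} {p : MvPolynomial (Fin K) ℂ} :
    p ∈ vIdeal X ↔ ∀ x ∈ X, eval x p = 0 := Iff.rfl

theorem vIdeal_anti {K : ℕ} {X Y : Set (Fin K → ℂ)} (h : X ⊆ Y) : vIdeal Y ≤ vIdeal X :=
  fun _ hp x hx => hp x (h hx)

theorem Good.inter {K : ℕ} {X : Set (Fin K → ℂ)} (hX : Good X) {e : ℕ} (he : 1 ≤ e)
    {p : MvPolynomial (Fin K) ℂ} (hp : p.IsHomogeneous e) : Good (X ∩ hypCone p) := by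
  refine ⟨⟨hX.zero, ?_⟩, ?_, ?_⟩
  · have := eval_smul_hom hp 0 0
    rw [smul_zero, zero_pow (by omega), zero_mul] at this
    exact this
  · rintro x ⟨h1, h2⟩ t
    refine ⟨hX.smul x h1 t, ?_⟩
    change eval (t • x) p = 0
    rw [eval_smul_hom hp, show eval x p = 0 from h2, mul_zero]
  · intro x hx
    refine ⟨hX.alg x fun r hr => hx r (vIdeal_anti Set.inter_subset_left hr), ?_⟩
    exact hx p (fun y hy => hy.2)

theorem Good.ne_top {K : ℕ} {X : Set (Fin K → ℂ)} (hX : Good X) : vIdeal X ≠ ⊤ := by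
  intro h
  have : (1 : MvPolynomial (Fin K) ℂ) ∈ vIdeal X := h ▸ Submodule.mem_top
  simpa using this 0 hX.zero

theorem Good.hcomp {K : ℕ} {X : Set (Fin K → ℂ)} (hX : Good X) {p : MvPolynomial (Fin K) ℂ}
    (hp : p ∈ vIdeal X) (d : ℕ) : homogeneousComponent d p ∈ vIdeal X := by
  intro x hx
  let u : Polynomial ℂ := ∑ i ∈ Finset.range (p.totalDegree + 1),
    Polynomial.monomial i (eval x (homogeneousComponent i p))
  have hu : u = 0 := by
    apply Polynomial.funext
    intro t
    have h := hp (t • x) (hX.smul x hx t)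
    rw [← sum_homogeneousComponent p, map_sum] at h
    simp only [u, Polynomial.eval_finsetSum, Polynomial.eval_monomial, Polynomial.eval_zero]
    rw [← h]
    refine Finset.sum_congr rfl fun i _ => ?_
    rw [eval_smul_hom (homogeneousComponent_isHomogeneous i p), mul_comm]
  by_cases hd : d < p.totalDegree + 1
  · have h2 : u.coeff d = eval x (homogeneousComponent d p) := by
      simp [u, Polynomial.finsetSum_coeff, Polynomial.coeff_monomial]
      omega
    rw [← h2, hu, Polynomial.coeff_zero]
  · rw [homogeneousComponent_eq_zero _ _ (by omega), map_zero]

/-- Krull dimension of the coordinate ring agrees with `coneDim`. -/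
theorem dim_coe {K : ℕ} (I : Ideal (MvPolynomial (Fin K) ℂ)) (hI : I ≠ ⊤) :
    ((ENat.toNat ((ringKrullDim (MvPolynomial (Fin K) ℂ ⧸ I)).unbotD 0) : ℕ) : WithBot ℕ∞)
      = ringKrullDim (MvPolynomial (Fin K) ℂ ⧸ I) := by
  have : Nontrivial (MvPolynomial (Fin K) ℂ ⧸ I) := Ideal.Quotient.nontrivial_iff.mpr hI
  have h0 := ringKrullDim_nonneg_of_nontrivial (R := MvPolynomial (Fin K) ℂ ⧸ I)
  have h1 := ringKrullDim_quotient_le I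
  rw [MvPolynomial.ringKrullDim_of_isNoetherianRing, ringKrullDim_eq_zero_of_field, zero_add] at h1
  revert h0 h1
  generalize ringKrullDim (MvPolynomial (Fin K) ℂ ⧸ I) = a
  intro h0 h1
  induction a with
  | bot => simp at h0
  | coe a =>
    induction a with
    | top =>
      exfalso
      have : ((⊤ : ℕ∞) : WithBot ℕ∞) ≤ ((Nat.card (Fin K) : ℕ∞) : WithBot ℕ∞) := h1
      rw [WithBot.coe_le_coe] at this
      simp at this
    | coe a => simp

theorem Good.coneDim_le {K : ℕ} {X : Set (Fin K → ℂ)} (hX : Good X) (k : ℕ) :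
    coneDim X ≤ k ↔ ringKrullDim (MvPolynomial (Fin K) ℂ ⧸ vIdeal X) ≤ (k : WithBot ℕ∞) := by
  rw [← dim_coe _ hX.ne_top]
  exact (Nat.cast_le (α := WithBot ℕ∞)).symm

theorem dim_anti {R : Type*} [CommRing R] {I J : Ideal R} (h : I ≤ J) :
    ringKrullDim (R ⧸ J) ≤ ringKrullDim (R ⧸ I) :=
  ringKrullDim_le_of_surjective (Ideal.Quotient.factor h) (Ideal.Quotient.factor_surjective h)

theorem coneDim_mono {K : ℕ} {X Y : Set (Fin K → ℂ)} (hX : (vIdeal X) ≠ ⊤) (h : X ⊆ Y) :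
    coneDim X ≤ coneDim Y := by
  have hY : vIdeal Y ≠ ⊤ := fun h' => hX (top_le_iff.mp (h' ▸ vIdeal_anti h))
  have := dim_anti (vIdeal_anti h)
  rw [← dim_coe _ hX, ← dim_coe _ hY] at this
  exact (Nat.cast_le (α := WithBot ℕ∞)).mp this

theorem dim_step {R : Type*} [CommRing R] {I J : Ideal R} (h : I ≤ J) {f : R} (hf : f ∈ J) {k : ℕ}
    (hI : ringKrullDim (R ⧸ I) ≤ ((k + 1 : ℕ) : WithBot ℕ∞))
    (hP : ∀ P ∈ I.minimalPrimes, f ∈ P → ringKrullDim (R ⧸ P) ≤ (k : WithBot ℕ∞)) :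
    ringKrullDim (R ⧸ J) ≤ (k : WithBot ℕ∞) := by
  rw [ringKrullDim_quotient] at hI ⊢
  refine iSup_le fun l => ?_
  have hle : I ≤ l.head.1.asIdeal := h.trans l.head.2
  obtain ⟨p, hp, hp'⟩ := Ideal.exists_minimalPrimes_le (J := l.head.1.asIdeal) hle
  let p' : PrimeSpectrum R := ⟨p, hp.1.1⟩
  by_cases hfp : f ∈ p
  · have h1 := hP p hp hfp
    rw [ringKrullDim_quotient] at h1
    let l2 : LTSeries (PrimeSpectrum.zeroLocus (R := R) p) :=
      { length := l.length
        toFun := fun i => ⟨(l i).1, fun x hx => (l.head_le i : l.head.1 ≤ (l i).1) (hp' hx)⟩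
        step := fun i => l.step i }
    exact (le_iSup (fun l : LTSeries (PrimeSpectrum.zeroLocus (R := R) p) =>
      (l.length : WithBot ℕ∞)) l2).trans h1
  · let l2 : LTSeries (PrimeSpectrum.zeroLocus (R := R) I) :=
      { length := l.length
        toFun := fun i => ⟨(l i).1, fun x hx => (l i).2 (h hx)⟩
        step := fun i => l.step i }
    have hlt : (⟨p', hp.1.2⟩ : PrimeSpectrum.zeroLocus (R := R) I) < l2.head := by
      refine lt_of_le_of_ne hp' fun he => hfp ?_
      have h3 : f ∈ l.head.1.asIdeal := l.head.2 hf
      have h4 : p' = l.head.1 := congrArg Subtype.val he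
      rw [← h4] at h3
      exact h3
    have h5 := (le_iSup (fun l : LTSeries (PrimeSpectrum.zeroLocus (R := R) I) =>
      (l.length : WithBot ℕ∞)) (l2.cons _ hlt)).trans hI
    have h6 : l.length + 1 ≤ k + 1 := by
      have : (((l2.cons _ hlt).length : ℕ) : WithBot ℕ∞) ≤ ((k + 1 : ℕ) : WithBot ℕ∞) := h5
      rw [Nat.cast_le] at this
      simpa [l2] using this
    exact_mod_cast (by omega : l.length ≤ k)

theorem dim_le_of_finite {A B : Type*} [CommRing A] [CommRing B] [Algebra A B]
    [Algebra.IsIntegral A B] : ringKrullDim B ≤ ringKrullDim A :=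
  Order.krullDim_le_of_strictMono (fun P => ⟨P.asIdeal.comap (algebraMap A B), inferInstance⟩)
    (fun P P' h => Ideal.IsIntegral.comap_lt_comap (R := A) (I := P.asIdeal) (J := P'.asIdeal) h)

/-- Lemma A. -/
theorem Good.le_of_cut {K k : ℕ} {X : Set (Fin K → ℂ)} (hX : Good X)
    (f : Fin k → MvPolynomial (Fin K) ℂ) (hf : ∀ i, ∃ e, 1 ≤ e ∧ (f i).IsHomogeneous e)
    (h0 : ∀ x ∈ X, (∀ i, eval x (f i) = 0) → x = 0) : coneDim X ≤ k := by
  rw [hX.coneDim_le]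
  choose e he hfe using hf
  set I := vIdeal X with hI
  let J : Ideal (MvPolynomial (Fin K) ℂ) := I ⊔ Ideal.span (Set.range f)
  have hJr : idealOfVars (Fin K) ℂ ≤ J.radical := by
    rw [← vanishingIdeal_zeroLocus_eq_radical (K := ℂ) J, idealOfVars, Ideal.span_le]
    rintro _ ⟨i, rfl⟩ x hx
    have : x = 0 := by
      apply h0 x (hX.alg x fun p hp => ?_) fun i => ?_
      · exact hx p (Ideal.mem_sup_left hp)
      · exact hx _ (Ideal.mem_sup_right (Ideal.subset_span ⟨i, rfl⟩))
    simp [this]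
  obtain ⟨r, hr⟩ := Ideal.exists_radical_pow_le_of_fg J (IsNoetherian.noetherian _)
  have hr' : idealOfVars (Fin K) ℂ ^ r ≤ J := (Ideal.pow_right_mono hJr r).trans hr
  let ψ : MvPolynomial (Fin k) ℂ →+* (MvPolynomial (Fin K) ℂ ⧸ I) :=
    (Ideal.Quotient.mk I).comp (aeval f).toRingHom
  let instA : Algebra (MvPolynomial (Fin k) ℂ) (MvPolynomial (Fin K) ℂ ⧸ I) := ψ.toAlgebra
  let instM : Module (MvPolynomial (Fin k) ℂ) (MvPolynomial (Fin K) ℂ ⧸ I) := instA.toModule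
  let instS : SMul (MvPolynomial (Fin k) ℂ) (MvPolynomial (Fin K) ℂ ⧸ I) := instA.toSMul
  let T : Set (MvPolynomial (Fin K) ℂ ⧸ I) :=
    (fun s : Fin K →₀ ℕ => Ideal.Quotient.mk I (monomial s 1)) '' {s | s.degree < r}
  have hT : T.Finite := (Finsupp.finite_of_degree_lt r).image _
  let S := Submodule.span (MvPolynomial (Fin k) ℂ) T
  have hsm : ∀ a b, a • b = ψ a * b := fun a b => rfl
  have key : ∀ d, ∀ p : MvPolynomial (Fin K) ℂ, p.IsHomogeneous d → Ideal.Quotient.mk I p ∈ S := by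
    intro d
    induction d using Nat.strong_induction_on with
    | _ d ih =>
    intro p hp
    have hdeg : ∀ s ∈ p.support, s.degree = d := fun s hs => by
      have := hp (mem_support_iff.mp hs)
      rw [Finsupp.degree_eq_weight_one]; exact this
    by_cases hd : d < r
    · rw [p.as_sum, map_sum]
      refine Submodule.sum_mem _ fun s hs => ?_
      have : Ideal.Quotient.mk I (monomial s (coeff s p)) =
          (C (coeff s p) : MvPolynomial (Fin k) ℂ) • Ideal.Quotient.mk I (monomial s 1) := by
        rw [hsm]
        simp only [ψ, RingHom.comp_apply]
        rw [← map_mul]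
        congr 1
        simp [algebraMap_eq, C_mul_monomial]
      rw [this]
      refine Submodule.smul_mem _ _ (Submodule.subset_span ⟨s, ?_, rfl⟩)
      change s.degree < r
      rw [hdeg s hs]; exact hd
    · have hpJ : p ∈ J := by
        apply hr'
        rw [mem_pow_idealOfVars_iff]
        intro s hs
        have := hdeg s hs
        omega
      obtain ⟨a, ha, b, hb, hab⟩ := Submodule.mem_sup.mp hpJ
      obtain ⟨c, hc⟩ := (Ideal.mem_span_range_iff_exists_fun).mp hb
      have h1 : p = homogeneousComponent d a + ∑ i, homogeneousComponent d (c i * f i) := by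
        rw [← map_sum, hc, ← map_add, hab, homogeneousComponent_eq_self hp]
      rw [h1, map_add, Ideal.Quotient.eq_zero_iff_mem.mpr (hX.hcomp ha d), zero_add, map_sum]
      refine Submodule.sum_mem _ fun i _ => ?_
      rw [← sum_homogeneousComponent (c i), Finset.sum_mul, map_sum, map_sum]
      refine Submodule.sum_mem _ fun j _ => ?_
      have h2 : (homogeneousComponent j (c i) * f i).IsHomogeneous (j + e i) :=
        (homogeneousComponent_isHomogeneous j (c i)).mul (hfe i)
      rw [homogeneousComponent_of_mem h2]
      split_ifs with hje
      · have h3 := ih j (by have := he i; omega) _ (homogeneousComponent_isHomogeneous j (c i))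
        have h4 := Submodule.smul_mem S (MvPolynomial.X i : MvPolynomial (Fin k) ℂ) h3
        rw [hsm] at h4
        rw [map_mul, mul_comm]
        simpa [ψ] using h4
      · rw [map_zero]; exact Submodule.zero_mem _
  have hfin : Module.Finite (MvPolynomial (Fin k) ℂ) (MvPolynomial (Fin K) ℂ ⧸ I) := by
    refine ⟨⟨hT.toFinset, ?_⟩⟩
    rw [hT.coe_toFinset, eq_top_iff]
    rintro y -
    obtain ⟨p, rfl⟩ := Ideal.Quotient.mk_surjective y
    rw [← sum_homogeneousComponent p, map_sum]
    exact Submodule.sum_mem _ fun j _ => key j _ (homogeneousComponent_isHomogeneous j p)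
  have : Algebra.IsIntegral (MvPolynomial (Fin k) ℂ) (MvPolynomial (Fin K) ℂ ⧸ I) :=
    Algebra.IsIntegral.of_finite _ _
  refine (dim_le_of_finite (A := MvPolynomial (Fin k) ℂ)).trans ?_
  rw [MvPolynomial.ringKrullDim_of_isNoetherianRing, ringKrullDim_eq_zero_of_field, zero_add]
  simp

theorem Good.eq_zero {K : ℕ} {X : Set (Fin K → ℂ)} (hX : Good X) (h : coneDim X ≤ 0) :
    ∀ x ∈ X, x = 0 := by
  intro x hx
  by_contra hx0
  obtain ⟨i, hi⟩ : ∃ i, x i ≠ 0 := by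
    by_contra hh; push Not at hh; exact hx0 (funext hh)
  rw [hX.coneDim_le] at h
  let ℓ : MvPolynomial (Fin K) ℂ →+* Polynomial ℂ :=
    (aeval fun i => Polynomial.C (x i) * Polynomial.X : MvPolynomial (Fin K) ℂ →ₐ[ℂ] _).toRingHom
  have hℓ : ∀ p t, (ℓ p).eval t = eval (t • x) p := by
    intro p t
    have : ((Polynomial.evalRingHom t).comp ℓ) = eval (t • x) := by
      apply MvPolynomial.ringHom_ext
      · intro c; simp [ℓ]
      · intro i; simp [ℓ]; ring
    exact congrArg (fun g => g p) this
  have hk : ∀ p ∈ vIdeal X, ℓ p = 0 := by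
    intro p hp
    apply Polynomial.funext
    intro t
    rw [hℓ, hp _ (hX.smul x hx t), Polynomial.eval_zero]
  let L : (MvPolynomial (Fin K) ℂ ⧸ vIdeal X) →+* Polynomial ℂ := Ideal.Quotient.lift _ ℓ hk
  have hsurj : Function.Surjective L := by
    intro u
    refine ⟨Ideal.Quotient.mk _ (Polynomial.aeval (C (x i)⁻¹ * MvPolynomial.X i) u), ?_⟩
    rw [Ideal.Quotient.lift_mk]
    change ((ℓ.comp (Polynomial.aeval (C (x i)⁻¹ * MvPolynomial.X i) :
      Polynomial ℂ →ₐ[ℂ] MvPolynomial (Fin K) ℂ).toRingHom)) u = RingHom.id _ u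
    congr 1
    apply Polynomial.ringHom_ext
    · intro c; simp [ℓ, algebraMap_eq]
    · simp only [RingHom.comp_apply, RingHom.id_apply]
      simp [ℓ, ← mul_assoc, ← Polynomial.C_mul, inv_mul_cancel₀ hi]
  have h1 := (ringKrullDim_le_of_surjective L hsurj).trans h
  rw [Polynomial.ringKrullDim_of_isNoetherianRing, ringKrullDim_eq_zero_of_field, zero_add] at h1
  have : ((1 : ℕ) : WithBot ℕ∞) ≤ ((0 : ℕ) : WithBot ℕ∞) := by exact_mod_cast h1
  rw [Nat.cast_le] at this
  omega

theorem exists_linear {K k : ℕ} (I : Ideal (MvPolynomial (Fin K) ℂ)) :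
    ∃ f : MvPolynomial (Fin K) ℂ, f.IsHomogeneous 1 ∧
      ∀ P ∈ I.minimalPrimes, f ∈ P →
        ringKrullDim (MvPolynomial (Fin K) ℂ ⧸ P) ≤ (k : WithBot ℕ∞) := by
  classical
  let E := homogeneousSubmodule (Fin K) ℂ 1
  let g : Ideal (MvPolynomial (Fin K) ℂ) → Subspace ℂ E := fun P =>
    (P.restrictScalars ℂ).comap E.subtype
  have hfin := I.finite_minimalPrimes_of_isNoetherianRing
  let s : Finset (Subspace ℂ E) := (hfin.toFinset.image g).erase ⊤
  have hs := Subspace.biUnion_ne_univ_of_top_notMem (s := s) (by simp [s])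
  obtain ⟨f, hf⟩ := (Set.ne_univ_iff_exists_notMem _).mp hs
  refine ⟨f.1, f.2, fun P hP hfP => ?_⟩
  have htop : g P = ⊤ := by
    by_contra hne
    apply hf
    simp only [Set.mem_iUnion]
    exact ⟨g P, by simp [s, hne]; exact ⟨P, hP, rfl⟩, hfP⟩
  have hX : ∀ i, (X i : MvPolynomial (Fin K) ℂ) ∈ P := fun i => by
    have : (⟨X i, isHomogeneous_X ℂ i⟩ : E) ∈ g P := htop ▸ Submodule.mem_top
    exact this
  let φ : ℂ →+* (MvPolynomial (Fin K) ℂ ⧸ P) := (Ideal.Quotient.mk P).comp C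
  have hsurj : Function.Surjective φ := by
    intro y
    obtain ⟨p, rfl⟩ := Ideal.Quotient.mk_surjective y
    induction p using MvPolynomial.induction_on with
    | C a => exact ⟨a, rfl⟩
    | add p r hp hr =>
      obtain ⟨a, ha⟩ := hp
      obtain ⟨b, hb⟩ := hr
      exact ⟨a + b, by rw [map_add, map_add, ha, hb]⟩
    | mul_X p i _ =>
      refine ⟨0, ?_⟩
      rw [map_zero, eq_comm, Ideal.Quotient.eq_zero_iff_mem]
      exact P.mul_mem_left _ (hX i)
  refine (ringKrullDim_le_of_surjective φ hsurj).trans ?_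
  rw [ringKrullDim_eq_zero_of_field]
  exact_mod_cast Nat.zero_le k

/-- Lemma B. -/
theorem Good.exists_cut {K : ℕ} (k : ℕ) : ∀ {X : Set (Fin K → ℂ)}, Good X → coneDim X ≤ k →
    ∃ f : Fin k → MvPolynomial (Fin K) ℂ, (∀ i, ∃ e, 1 ≤ e ∧ (f i).IsHomogeneous e) ∧
      ∀ x ∈ X, (∀ i, eval x (f i) = 0) → x = 0 := by
  induction k with
  | zero =>
    intro X hX h
    exact ⟨Fin.elim0, fun i => i.elim0, fun x hx _ => hX.eq_zero h x hx⟩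
  | succ k ih =>
    intro X hX h
    obtain ⟨f, hf1, hf2⟩ := exists_linear (k := k) (vIdeal X)
    have hY := hX.inter le_rfl hf1
    have hd : coneDim (X ∩ hypCone f) ≤ k := by
      rw [hY.coneDim_le]
      exact dim_step (vIdeal_anti Set.inter_subset_left) (f := f) (fun x hx => hx.2)
        ((hX.coneDim_le _).mp h) hf2
    obtain ⟨g, hg1, hg2⟩ := ih hY hd
    refine ⟨Fin.cons f g, fun i => ?_, fun x hx hi => ?_⟩
    · refine Fin.cases ?_ ?_ i
      · exact ⟨1, le_rfl, by simpa using hf1⟩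
      · intro j; simpa using hg1 j
    · refine hg2 x ⟨hx, ?_⟩ fun j => ?_
      · exact hi 0
      · simpa using hi j.succ

theorem Good.le_inter {K : ℕ} {X : Set (Fin K → ℂ)} (hX : Good X) {e : ℕ} (he : 1 ≤ e)
    {p : MvPolynomial (Fin K) ℂ} (hp : p.IsHomogeneous e) :
    coneDim X ≤ coneDim (X ∩ hypCone p) + 1 := by
  obtain ⟨g, hg1, hg2⟩ := (hX.inter he hp).exists_cut _ le_rfl
  refine hX.le_of_cut (Fin.cons p g : Fin (coneDim (X ∩ hypCone p) + 1) → _) (fun i => ?_)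
    (fun x hx hi => ?_)
  · refine Fin.cases ?_ ?_ i
    · exact ⟨e, he, by simpa using hp⟩
    · intro j; simpa using hg1 j
  · refine hg2 x ⟨hx, ?_⟩ fun j => ?_
    · exact hi 0
    · simpa using hi j.succ

theorem matroid_aux {α : Type*} [DecidableEq α] (c : Finset α → ℕ) (h0 : c ∅ = 0)
    (hmono : ∀ A B, A ⊆ B → c A ≤ c B) (hins : ∀ i A, c (insert i A) ≤ c A + 1)
    (hstar : ∀ J R, c J = J.card → J ⊆ R → (∀ i ∈ R, i ∉ J → c (insert i J) = c J) → c R ≤ c J)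
    (A B : Finset α) : c (A ∪ B) + c (A ∩ B) ≤ c A + c B := by
  have hle : ∀ D E : Finset α, c (D ∪ E) ≤ c D + E.card := by
    intro D E
    induction E using Finset.induction_on with
    | empty => simp
    | insert i E hi ih =>
      rw [Finset.union_insert, Finset.card_insert_of_notMem hi]
      have := hins i (D ∪ E)
      omega
  have hcard : ∀ E : Finset α, c E ≤ E.card := fun E => by
    have := hle ∅ E
    rw [Finset.empty_union, h0, zero_add] at this
    exact this
  have hsub : ∀ J E : Finset α, c J = J.card → E ⊆ J → c E = E.card := by
    intro J E hJ hE
    refine le_antisymm (hcard E) ?_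
    have := hle E (J \ E)
    rw [Finset.union_sdiff_of_subset hE, hJ, Finset.card_sdiff_of_subset hE] at this
    have := Finset.card_le_card hE
    omega
  have hext : ∀ m : ℕ, ∀ J R : Finset α, c J = J.card → J ⊆ R → R.card - J.card = m →
      ∃ J', J ⊆ J' ∧ J' ⊆ R ∧ c J' = J'.card ∧ c R = J'.card := by
    intro m
    induction m using Nat.strong_induction_on with
    | _ m ih =>
    intro J R hJ hJR hm
    by_cases hh : ∀ i ∈ R, i ∉ J → c (insert i J) = c J
    · refine ⟨J, subset_rfl, hJR, hJ, ?_⟩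
      rw [← hJ]
      exact le_antisymm (hstar J R hJ hJR hh) (hmono _ _ hJR)
    · push Not at hh
      obtain ⟨i, hiR, hiJ, hne⟩ := hh
      have h1 := hins i J
      have h2 := hmono J (insert i J) (Finset.subset_insert _ _)
      have h3 := Finset.card_insert_of_notMem hiJ
      have h4 : insert i J ⊆ R := Finset.insert_subset hiR hJR
      have h5 := Finset.card_le_card h4
      obtain ⟨J', a, b, c', d⟩ := ih (R.card - (insert i J).card) (by omega) (insert i J) R
        (by omega) h4 rfl
      exact ⟨J', (Finset.subset_insert _ _).trans a, b, c', d⟩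
  obtain ⟨J, -, hJ1, hJ2, hJ3⟩ := hext _ ∅ (A ∩ B) (by simp [h0]) (Finset.empty_subset _) rfl
  obtain ⟨L, hL0, hL1, hL2, hL3⟩ := hext _ J (A ∪ B) hJ2
    (hJ1.trans (Finset.inter_subset_left.trans Finset.subset_union_left)) rfl
  have e1 := hsub L (L ∩ A) hL2 Finset.inter_subset_left
  have e2 := hsub L (L ∩ B) hL2 Finset.inter_subset_left
  have e3 := hmono (L ∩ A) A Finset.inter_subset_right
  have e4 := hmono (L ∩ B) B Finset.inter_subset_right
  have e5 := Finset.card_union_add_card_inter (L ∩ A) (L ∩ B)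
  have e6 : (L ∩ A) ∪ (L ∩ B) = L := by
    rw [← Finset.inter_union_distrib_left]; exact Finset.inter_eq_left.mpr hL1
  have e7 : J ⊆ (L ∩ A) ∩ (L ∩ B) := by
    intro x hx
    have := hJ1 hx
    have := hL0 hx
    simp_all
  have e8 := Finset.card_le_card e7
  rw [e6] at e5
  omega

theorem good_coneOf {K n : ℕ} {I : Ideal (MvPolynomial (Fin K) ℂ)} (hV : IsVariety n I) :
    Good (coneOf I) := by
  obtain ⟨hp, ⟨S, hS, rfl⟩, hdim⟩ := hV
  have hmem : ∀ x, x ∈ coneOf (Ideal.span S) ↔ ∀ p ∈ S, eval x p = 0 := by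
    intro x
    refine ⟨fun h p hp => h p (Ideal.subset_span hp), fun h p hp => ?_⟩
    have : Ideal.span S ≤ RingHom.ker (eval x) := Ideal.span_le.mpr h
    exact this hp
  refine ⟨?_, ?_, ?_⟩
  · rw [hmem]
    intro p hpS
    obtain ⟨e, he⟩ := hS p hpS
    rcases Nat.eq_zero_or_pos e with rfl | he'
    · by_contra hne
      have hC := (totalDegree_eq_zero_iff_eq_C (p := p)).mp
        ((totalDegree_zero_iff_isHomogeneous _).mpr he)
      rw [hC, eval_C] at hne
      apply hp.ne_top
      refine Ideal.eq_top_of_isUnit_mem _ (Ideal.subset_span hpS) ?_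
      rw [hC]
      exact (isUnit_iff_ne_zero.mpr hne).map C
    · have := eval_smul_hom he 0 0
      rwa [smul_zero, zero_pow (by omega), zero_mul] at this
  · intro x hx t
    rw [hmem] at hx ⊢
    intro p hpS
    obtain ⟨e, he⟩ := hS p hpS
    rw [eval_smul_hom he, hx p hpS, mul_zero]
  · intro x hx p hp'
    exact hx p fun y hy => hy p hp'

theorem vIdeal_coneOf {K : ℕ} {I : Ideal (MvPolynomial (Fin K) ℂ)} (hI : I.IsPrime) :
    vIdeal (coneOf I) = I :=
  IsPrime.vanishingIdeal_zeroLocus (K := ℂ) I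

theorem interCone_insert {K q : ℕ} (I : Ideal (MvPolynomial (Fin K) ℂ))
    (Q : Fin q → MvPolynomial (Fin K) ℂ) (i : Fin q) (R : Finset (Fin q)) :
    interCone I Q (insert i R) = interCone I Q R ∩ hypCone (Q i) := by
  ext x; simp [interCone]; tauto

theorem interCone_empty {K q : ℕ} (I : Ideal (MvPolynomial (Fin K) ℂ))
    (Q : Fin q → MvPolynomial (Fin K) ℂ) : interCone I Q ∅ = coneOf I := by
  simp [interCone]

theorem interCone_anti {K q : ℕ} (I : Ideal (MvPolynomial (Fin K) ℂ))
    (Q : Fin q → MvPolynomial (Fin K) ℂ) {R R' : Finset (Fin q)} (h : R ⊆ R') :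
    interCone I Q R' ⊆ interCone I Q R := by
  intro x hx
  simp only [interCone, Set.mem_inter_iff, Set.mem_iInter] at hx ⊢
  exact ⟨hx.1, fun j hj => hx.2 j (h hj)⟩

/-- **Lemma 2.3 (i).** The codimension function is submodular:
`c(R₁ ∪ R₂) + c(R₁ ∩ R₂) ≤ c(R₁) + c(R₂)`. -/
theorem statement9 {M n N q : ℕ} (hn : 1 ≤ n) (hNn : n ≤ N) (hq : N + 1 ≤ q)
    (I : Ideal (MvPolynomial (Fin (M + 1)) ℂ)) (hV : IsSmoothVariety n I)
    (Q : Fin q → MvPolynomial (Fin (M + 1)) ℂ) (d : Fin q → ℕ)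
    (hd : ∀ j, 1 ≤ d j) (hQ : ∀ j, (Q j).IsHomogeneous (d j))
    (hsub : InSubgenPos n N I Q) :
    ∀ R₁ R₂ : Finset (Fin q),
      cdim n I Q (R₁ ∪ R₂) + cdim n I Q (R₁ ∩ R₂) ≤ cdim n I Q R₁ + cdim n I Q R₂ := by
  obtain ⟨hvar, -⟩ := hV
  obtain ⟨hns, -, hII⟩ := hsub
  have hgood : ∀ R, Good (interCone I Q R) := by
    intro R
    induction R using Finset.induction_on with
    | empty => rw [interCone_empty]; exact good_coneOf hvar
    | insert i R _ ih => rw [interCone_insert]; exact ih.inter (hd i) (hQ i)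
  have hdim0 : ringKrullDim (MvPolynomial (Fin (M + 1)) ℂ ⧸ vIdeal (coneOf I)) =
      ((n + 1 : ℕ) : WithBot ℕ∞) := by
    rw [vIdeal_coneOf hvar.1]; exact hvar.2.2
  have hc0 : coneDim (interCone I Q ∅) = n + 1 := by
    rw [interCone_empty]
    have := dim_coe _ (good_coneOf hvar).ne_top
    rw [hdim0] at this
    have h2 := Nat.cast_injective (R := WithBot ℕ∞) this
    unfold coneDim
    rw [hdim0]; exact h2
  have hmono : ∀ A B, A ⊆ B → coneDim (interCone I Q B) ≤ coneDim (interCone I Q A) :=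
    fun A B h => coneDim_mono (hgood B).ne_top (interCone_anti I Q h)
  have hle : ∀ A, coneDim (interCone I Q A) ≤ n + 1 := fun A =>
    hc0 ▸ hmono ∅ A (Finset.empty_subset _)
  have hins : ∀ i A, coneDim (interCone I Q A) ≤ coneDim (interCone I Q (insert i A)) + 1 := by
    intro i A
    rw [interCone_insert]
    exact (hgood A).le_inter (hd i) (hQ i)
  have hsing : ∀ i, coneDim (interCone I Q (insert i ∅)) ≤ n := by
    intro i
    rw [(hgood _).coneDim_le, interCone_insert, interCone_empty]
    refine dim_step (I := vIdeal (coneOf I)) (f := Q i) (vIdeal_anti Set.inter_subset_left)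
      (fun x hx => hx.2) hdim0.le ?_
    intro P hP hf
    exfalso
    rw [vIdeal_coneOf hvar.1] at hP
    have := hvar.1
    rw [Ideal.minimalPrimes_eq_subsingleton_self, Set.mem_singleton_iff] at hP
    subst hP
    exact hns i fun x hx => hx _ hf
  -- submodularity through the matroid argument
  intro R₁ R₂
  have hcins : ∀ i A, cdim n I Q (insert i A) ≤ cdim n I Q A + 1 := fun i A => by
    have := hins i A
    simp only [cdim]; omega
  have hcmono : ∀ A B, A ⊆ B → cdim n I Q A ≤ cdim n I Q B := fun A B h => by
    have := hmono A B h
    simp only [cdim]; omega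
  have hce : cdim n I Q ∅ = 0 := by simp [cdim, hc0]
  have hcun : ∀ D E : Finset (Fin q), cdim n I Q (D ∪ E) ≤ cdim n I Q D + E.card := by
    intro D E
    induction E using Finset.induction_on with
    | empty => simp
    | insert i E hi ih =>
      rw [Finset.union_insert, Finset.card_insert_of_notMem hi]
      have := hcins i (D ∪ E)
      omega
  refine matroid_aux (cdim n I Q) hce hcmono hcins ?_ R₁ R₂
  intro J R hJ hJR hi
  by_cases hJ0 : J = ∅
  · subst hJ0
    have : R = ∅ := by
      by_contra hne
      obtain ⟨i, hiR⟩ := Finset.nonempty_iff_ne_empty.mpr hne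
      have h1 := hi i hiR (by simp)
      rw [hce] at h1
      have h2 := hsing i
      simp only [cdim] at h1
      omega
    rw [this]
  by_cases hz : ∃ x ∈ interCone I Q J, x ≠ 0
  · have hJle : J.card ≤ n + 1 := by rw [← hJ]; simp only [cdim]; omega
    have hgen : GenPos n I Q J := by
      intro J' hJ' _ _
      have h1 := hcun J' (J \ J')
      rw [Finset.union_sdiff_of_subset hJ', hJ, Finset.card_sdiff_of_subset hJ'] at h1
      have h2 := Finset.card_le_card hJ'
      have h3 : coneDim (interCone I Q J') ≤ n + 1 - J'.card := by
        have := hle J'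
        simp only [cdim] at h1
        omega
      exact (hgood J').exists_cut _ h3
    obtain ⟨σ, hσ, hσd, hσi⟩ := hII J (Finset.card_pos.mpr (Finset.nonempty_iff_ne_empty.mpr hJ0))
      hJle hgen hz
    have hsub : σ ⊆ interCone I Q R := by
      intro x hx
      have hxJ := hσ.1 hx
      simp only [interCone, Set.mem_inter_iff, Set.mem_iInter] at hxJ ⊢
      refine ⟨hxJ.1, fun j hj => ?_⟩
      by_cases hjJ : j ∈ J
      · exact hxJ.2 j hjJ
      · refine hσi j hjJ ?_ hx
        have h1 := hi j hj hjJ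
        have h2 := hle J
        have h3 := hle (insert j J)
        simp only [cdim] at h1
        omega
    have h4 := coneDim_mono hσ.2.2.1.ne_top hsub
    simp only [cdim]
    omega
  · push Not at hz
    have h1 : coneDim (interCone I Q J) ≤ 0 :=
      (hgood J).le_of_cut Fin.elim0 (fun i => i.elim0) (fun x hx _ => hz x hx)
    simp only [cdim]
    omega

end SMT
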